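/- Let X be a locally compact zero-dimensional space, let S ⊆ Homeo(X) with 1 ∈ S and S = S⁻¹, such that S is equicontinuous with respect to some compatible uniformity, and let G = ⟨S⟩. Let U be an open subset of X and write U* for the union of all compact G-invariant subsets of U. If U* is open in X and every point of U* is S-recurrent, then the G-orbit closure relation restricted to U* × U* is closed. -/

import Mathlib

open Filter Topology Set Pointwise Uniformity

namespace Reid

/-- The group of self-homeomorphisms of a space, with `(f * g) x = f (g x)`. -/
instance {X : Type*} [TopologicalSpace X] : Group (X ≃ₜ X) where
  mul f g := g.trans f
  one := Homeomorph.refl X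
  inv := Homeomorph.symm
  mul_assoc f g h := Homeomorph.ext fun _ => rfl
  one_mul f := Homeomorph.ext fun _ => rfl
  mul_one f := Homeomorph.ext fun _ => rfl
  inv_mul_cancel f := Homeomorph.ext f.symm_apply_apply

/-- The tautological action of the homeomorphism group on the space. -/
instance {X : Type*} [TopologicalSpace X] : MulAction (X ≃ₜ X) X where
  smul f x := f x
  one_smul _ := rfl
  mul_smul _ _ _ := rfl

/-- A topological space is zero-dimensional if it has a base of clopen sets
(Hausdorffness is imposed separately as an instance). -/
def ZeroDimensional (X : Type*) [TopologicalSpace X] : Prop :=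
  ∃ B : Set (Set X), TopologicalSpace.IsTopologicalBasis B ∧ ∀ U ∈ B, IsClopen U

/-- A set `S` of homeomorphisms is equicontinuous at `x` with respect to a uniformity `u` on `X`
if for every entourage `E` there is a neighbourhood `U` of `x` such that `(s x, s y) ∈ E`
for all `s ∈ S` and `y ∈ U`. -/
def EquicontinuousAtPt {X : Type*} [TopologicalSpace X] (u : UniformSpace X)
    (S : Set (X ≃ₜ X)) (x : X) : Prop :=
  ∀ E ∈ u.uniformity, ∃ U ∈ 𝓝 x, ∀ s ∈ S, ∀ y ∈ U, (s x, s y) ∈ E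

/-- A set of homeomorphisms is equicontinuous if it is equicontinuous at every point. -/
def EquicontinuousSet {X : Type*} [TopologicalSpace X] (u : UniformSpace X)
    (S : Set (X ≃ₜ X)) : Prop :=
  ∀ x : X, EquicontinuousAtPt u S x

/-- The word length of `g` with respect to a generating set `S` with `1 ∈ S = S⁻¹`:
the least `n` with `g ∈ S ^ n`. -/
noncomputable def wordLen {G : Type*} [Group G] (S : Set G) (g : G) : ℕ :=
  sInf {n : ℕ | g ∈ S ^ n}

/-- The set `K(g) = S^(|g|-1) g`. -/
def Kset {G : Type*} [Group G] (S : Set G) (g : G) : Set G :=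
  S ^ (wordLen S g - 1) * {g}

/-- A net in `α`: a function to `α` from a nonempty directed preorder. -/
structure Net (α : Type u) : Type (u + 1) where
  ι : Type u
  str : Preorder ι
  directed : IsDirected ι fun a b => str.le a b
  nonempty : Nonempty ι
  toFun : ι → α

/-- The `atTop` filter on the index type of a net. -/
def Net.atTop {α : Type u} (N : Net α) : Filter N.ι :=
  @Filter.atTop N.ι N.str

/-- A point `x` is `S`-recurrent if for every net `(g_i)` in `G = ⟨S⟩` with `|g_i| → ∞` and every
neighbourhood `U` of `x`, there are an integer `n`, a subnet `(g_{φ(j)})` and elements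
`c_j ∈ K(g_{φ(j)})` with `c_j x ∈ U` and `|c_j| ≤ n` for all `j`. -/
def SRecurrent {X : Type u} [TopologicalSpace X] (S : Set (X ≃ₜ X)) (x : X) : Prop :=
  ∀ N : Net (X ≃ₜ X), (∀ i, N.toFun i ∈ Subgroup.closure S) →
    Filter.Tendsto (fun i => wordLen S (N.toFun i)) N.atTop Filter.atTop →
    ∀ U ∈ 𝓝 x,
      ∃ (n : ℕ) (M : Net (X ≃ₜ X)) (φ : M.ι → N.ι) (c : M.ι → (X ≃ₜ X)),
        (∀ j, M.toFun j = N.toFun (φ j)) ∧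
        Filter.Tendsto φ M.atTop N.atTop ∧
        ∀ j, c j ∈ Kset S (N.toFun (φ j)) ∧ (c j) x ∈ U ∧ wordLen S (c j) ≤ n

section WordLength

variable {H : Type*} [Group H] {S : Set H}

theorem wordLen_inv (hSinv : S⁻¹ = S) (g : H) : wordLen S g⁻¹ = wordLen S g := by
  unfold wordLen
  congr 1
  ext n
  simp only [mem_ofPred_eq]
  rw [← Set.mem_inv, ← inv_pow, hSinv]

theorem mem_pow_of_wordLen_le (hS1 : 1 ∈ S) {g : H} {m n : ℕ} (hg : g ∈ S ^ m)
    (hn : wordLen S g ≤ n) : g ∈ S ^ n :=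
  Set.pow_subset_pow_right hS1 hn (Nat.sInf_mem (s := {n : ℕ | g ∈ S ^ n}) ⟨m, hg⟩)

theorem exists_mem_pow_of_mem_closure (hSinv : S⁻¹ = S) {g : H}
    (hg : g ∈ Subgroup.closure S) : ∃ n, g ∈ S ^ n := by
  induction hg using Subgroup.closure_induction with
  | mem x hx => exact ⟨1, by simpa using hx⟩
  | one => exact ⟨0, by simp⟩
  | mul x y _ _ hx hy =>
    obtain ⟨m, hm⟩ := hx
    obtain ⟨n, hn⟩ := hy
    exact ⟨m + n, by rw [pow_add]; exact Set.mul_mem_mul hm hn⟩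
  | inv x _ hx =>
    obtain ⟨m, hm⟩ := hx
    exact ⟨m, by rw [← Set.mem_inv, ← inv_pow, hSinv]; exact hm⟩

theorem pow_subset_closure (n : ℕ) : S ^ n ⊆ (Subgroup.closure S : Set H) := by
  induction n with
  | zero => simp
  | succ n ih =>
    rw [pow_succ]
    rintro _ ⟨a, ha, b, hb, rfl⟩
    exact mul_mem (ih ha) (Subgroup.subset_closure hb)

end WordLength

theorem mul_homeomorph_apply {X : Type*} [TopologicalSpace X] (f g : X ≃ₜ X) (x : X) :
    (f * g) x = f (g x) := rfl

theorem ZeroDimensional.exists_isCompact_isOpen_between {X : Type*} [TopologicalSpace X]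
    [T2Space X] [LocallyCompactSpace X] (hzd : ZeroDimensional X) {K O : Set X}
    (hK : IsCompact K) (hO : IsOpen O) (hKO : K ⊆ O) :
    ∃ V, IsCompact V ∧ IsOpen V ∧ K ⊆ V ∧ V ⊆ O := by
  obtain ⟨B, hB, hclopen⟩ := hzd
  refine hK.induction_on (p := fun s => ∃ V, IsCompact V ∧ IsOpen V ∧ s ⊆ V ∧ V ⊆ O)
    ⟨∅, isCompact_empty, isOpen_empty, subset_rfl, empty_subset _⟩ ?_ ?_ ?_
  · rintro s t hst ⟨V, h1, h2, h3, h4⟩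
    exact ⟨V, h1, h2, hst.trans h3, h4⟩
  · rintro s t ⟨V, h1, h2, h3, h4⟩ ⟨W, k1, k2, k3, k4⟩
    exact ⟨V ∪ W, h1.union k1, h2.union k2, union_subset_union h3 k3, union_subset h4 k4⟩
  · intro x hx
    obtain ⟨C, hC, hCO, hCc⟩ := local_compact_nhds (hO.mem_nhds (hKO hx))
    obtain ⟨W, hWB, hxW, hWC⟩ := hB.mem_nhds_iff.1 hC
    exact ⟨W, mem_nhdsWithin_of_mem_nhds ((hB.isOpen hWB).mem_nhds hxW), W,
      hCc.of_isClosed_subset (hclopen W hWB).isClosed hWC, hB.isOpen hWB, subset_rfl,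
      hWC.trans hCO⟩

/-- An equicontinuous set of homeomorphisms is uniformly equicontinuous along a compact set. -/
theorem EquicontinuousSet.exists_entourage {X : Type*} [u : UniformSpace X] {S : Set (X ≃ₜ X)}
    (hS : EquicontinuousSet u S) {K : Set X} (hK : IsCompact K) {E : Set (X × X)} (hE : E ∈ 𝓤 X) :
    ∃ D ∈ 𝓤 X, ∀ k ∈ K, ∀ y, (k, y) ∈ D → ∀ s ∈ S, (s k, s y) ∈ E := by
  obtain ⟨E', hE', hsymm, hcomp⟩ := comp_symm_mem_uniformity_sets hE
  choose W hW hWE using fun x => hS x E' hE'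
  obtain ⟨D, hD, hcov⟩ := lebesgue_number_lemma_nhds hK fun x _ => hW x
  refine ⟨D, hD, fun k hk y hy s hs => ?_⟩
  obtain ⟨a, ha⟩ := hcov k hk
  exact hcomp ⟨s a, hsymm.symm _ _ (hWE a s hs k (ha (UniformSpace.mem_ball_self k hD))),
    hWE a s hs y (ha hy)⟩

/-- Powers of an equicontinuous set of homeomorphisms are uniformly equicontinuous along a
compact invariant set. -/
theorem EquicontinuousSet.exists_entourage_pow {X : Type*} [u : UniformSpace X]
    {S : Set (X ≃ₜ X)} (hS : EquicontinuousSet u S) {K : Set X} (hK : IsCompact K)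
    (hinv : ∀ s ∈ S, ∀ k ∈ K, s k ∈ K) (n : ℕ) {E : Set (X × X)} (hE : E ∈ 𝓤 X) :
    ∃ D ∈ 𝓤 X, ∀ k ∈ K, ∀ y, (k, y) ∈ D → ∀ g ∈ S ^ n, (g k, g y) ∈ E := by
  induction n with
  | zero =>
    refine ⟨E, hE, fun k _ y hy g hg => ?_⟩
    rw [pow_zero, Set.mem_one] at hg
    subst hg
    exact hy
  | succ n ih =>
    obtain ⟨D, hD, h⟩ := ih
    obtain ⟨D', hD', h'⟩ := hS.exists_entourage hK hD
    refine ⟨D', hD', fun k hk y hy g hg => ?_⟩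
    rw [pow_succ] at hg
    obtain ⟨f, hf, s, hs, rfl⟩ := hg
    exact h (s k) (hinv s hs k hk) (s y) (h' k hk y hy s hs) f hf

/-- A point of `V` that the group maps out of `V` is mapped out of `V` by some `s * h` with `s ∈ S`
such that all words of length at most the length of `h` keep the point in `V`. -/
theorem exists_minimal_escape {X : Type*} [TopologicalSpace X] {S : Set (X ≃ₜ X)} (hS1 : 1 ∈ S)
    (hSinv : S⁻¹ = S) {V : Set X} {x : X} (hx : x ∈ V) {g : X ≃ₜ X}
    (hg : g ∈ Subgroup.closure S) (hgx : g x ∉ V) :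
    ∃ h ∈ Subgroup.closure S, ∃ s ∈ S, h ∈ S ^ wordLen S h ∧ s (h x) ∉ V ∧
      ∀ k ∈ S ^ wordLen S h, k x ∈ V := by
  classical
  have hex : ∃ m, ∃ g ∈ S ^ m, g x ∉ V :=
    (exists_mem_pow_of_mem_closure hSinv hg).imp fun n hn => ⟨g, hn, hgx⟩
  obtain ⟨f, hf, hfx⟩ := Nat.find_spec hex
  have hmin : ∀ m < Nat.find hex, ∀ k ∈ S ^ m, k x ∈ V := fun m hm k hk => by
    by_contra hkx
    exact Nat.find_min hex hm ⟨k, hk, hkx⟩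
  rcases hn : Nat.find hex with _ | m
  · rw [hn, pow_zero, Set.mem_one] at hf
    exact absurd (hf ▸ hx : f x ∈ V) hfx
  rw [hn] at hf hmin
  rw [pow_succ'] at hf
  obtain ⟨s, hs, h, hh, rfl⟩ := hf
  have hle : wordLen S h ≤ m := Nat.sInf_le hh
  have hmem := mem_pow_of_wordLen_le hS1 hh le_rfl
  refine ⟨h, pow_subset_closure m hh, s, hs, hmem, hfx, fun k hk => ?_⟩
  exact hmin _ (Nat.lt_succ_of_le hle) k hk

/-- The set-up of `exists_minimal_escape` can be arranged near a point `z` if points escaping from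
the compact set `V` accumulate at `x`. -/
theorem exists_clusterPt_escape {X : Type*} [TopologicalSpace X] {S : Set (X ≃ₜ X)} (hS1 : 1 ∈ S)
    (hSinv : S⁻¹ = S) {V : Set X} (hV : IsCompact V) {x : X} (hxV : V ∈ 𝓝 x)
    (hesc : ∀ N ∈ 𝓝 x, ∃ y ∈ N, ∃ g ∈ Subgroup.closure S, g y ∉ V) :
    ∃ z ∈ V, ∀ N ∈ 𝓝 x, ∀ W ∈ 𝓝 z, ∃ y ∈ N, ∃ h ∈ Subgroup.closure S, ∃ s ∈ S,
      h ∈ S ^ wordLen S h ∧ s (h y) ∉ V ∧ (∀ k ∈ S ^ wordLen S h, k y ∈ V) ∧ h y ∈ W := by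
  let T : Set (X × X) := {p | ∃ h ∈ Subgroup.closure S, ∃ s ∈ S,
      h ∈ S ^ wordLen S h ∧ s (h p.1) ∉ V ∧ (∀ k ∈ S ^ wordLen S h, k p.1 ∈ V) ∧ h p.1 = p.2}
  let F : Filter X := map Prod.snd (comap Prod.fst (𝓝 x) ⊓ 𝓟 T)
  have hne : F.NeBot := by
    refine Filter.NeBot.map ?_ _
    rw [Filter.inf_principal_neBot_iff]
    rintro A ⟨N, hN, hNA⟩
    obtain ⟨y, hy, g, hg, hgy⟩ := hesc (N ∩ V) (inter_mem hN hxV)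
    obtain ⟨h, hh, s, hs, h1, h2, h3⟩ := exists_minimal_escape hS1 hSinv hy.2 hg hgy
    exact ⟨(y, h y), hNA hy.1, h, hh, s, hs, h1, h2, h3, rfl⟩
  have hFV : F ≤ 𝓟 V := by
    rw [le_principal_iff]
    refine mem_inf_of_right ?_
    rintro ⟨y, w⟩ ⟨h, -, s, -, h1, -, h3, h4⟩
    change w ∈ V
    rw [← show h y = w from h4]
    exact h3 h h1
  obtain ⟨z, hzV, hz⟩ := hV hFV
  refine ⟨z, hzV, fun N hN W hW => ?_⟩
  have hmem : Prod.snd '' (Prod.fst ⁻¹' N ∩ T) ∈ F :=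
    image_mem_map (inter_mem_inf (preimage_mem_comap hN) (mem_principal_self T))
  obtain ⟨w, hwW, ⟨y, w'⟩, ⟨hyN, h, hh, s, hs, h1, h2, h3, h4⟩, rfl⟩ :=
    (clusterPt_iff_nonempty.1 hz) hW hmem
  exact ⟨y, hyN, h, hh, s, hs, h1, h2, h3, by rw [h4]; exact hwW⟩

/-- If `V` is a compact open set of recurrent points with relatively compact orbits and the orbit
of `x` stays in `V`, then so do the orbits of all points in a neighbourhood of `x`. -/
theorem exists_nhds_forall_mem_of_sRecurrent {X : Type u} [u : UniformSpace X]
    {S : Set (X ≃ₜ X)} (hS1 : 1 ∈ S) (hSinv : S⁻¹ = S) (hS : EquicontinuousSet u S)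
    {V : Set X} (hVc : IsCompact V) (hVo : IsOpen V)
    (hcpt : ∀ z ∈ V, ∃ K, IsCompact K ∧ z ∈ K ∧ ∀ s ∈ S, ∀ k ∈ K, s k ∈ K)
    (hrec : ∀ z ∈ V, SRecurrent S z) {x : X}
    (hx : ∀ g ∈ Subgroup.closure S, g x ∈ V) :
    ∃ N ∈ 𝓝 x, ∀ y ∈ N, ∀ g ∈ Subgroup.closure S, g y ∈ V := by
  by_contra! hesc
  have hxV : x ∈ V := hx 1 (one_mem _)
  obtain ⟨z, hzV, hz⟩ := exists_clusterPt_escape hS1 hSinv hVc (hVo.mem_nhds hxV) hesc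
  obtain ⟨E, hE, hEV⟩ : ∃ E ∈ 𝓤 X, ∀ a ∈ V, ∀ b, (a, b) ∈ E → b ∈ V := by
    obtain ⟨E, hE, h⟩ := lebesgue_number_of_compact_open hVc hVo subset_rfl
    exact ⟨E, hE, fun a ha b hb => h.2 a ha hb⟩
  let I : Type u := {N : Set X // N ∈ 𝓝 x}ᵒᵈ × {W : Set X // W ∈ 𝓝 z}ᵒᵈ
  have : IsDirected I (· ≤ ·) := ⟨fun a b =>
    ⟨(OrderDual.toDual ⟨_, inter_mem (OrderDual.ofDual a.1).2 (OrderDual.ofDual b.1).2⟩,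
      OrderDual.toDual ⟨_, inter_mem (OrderDual.ofDual a.2).2 (OrderDual.ofDual b.2).2⟩),
      ⟨inter_subset_left, inter_subset_left⟩, ⟨inter_subset_right, inter_subset_right⟩⟩⟩
  have : Nonempty I := ⟨(OrderDual.toDual ⟨univ, univ_mem⟩, OrderDual.toDual ⟨univ, univ_mem⟩)⟩
  choose y hyN h hh s hs hlen hout hin hyW using fun i : I =>
    hz (OrderDual.ofDual i.1).1 (OrderDual.ofDual i.1).2
      (OrderDual.ofDual i.2).1 (OrderDual.ofDual i.2).2
  let N : Net (X ≃ₜ X) := ⟨I, inferInstance, inferInstance, inferInstance, fun i => (h i)⁻¹⟩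
  have htend : Tendsto (fun i => wordLen S (N.toFun i)) N.atTop atTop := by
    refine tendsto_atTop.2 fun n => ?_
    obtain ⟨K, hK, hxK, hKS⟩ := hcpt x hxV
    obtain ⟨D, hD, hDE⟩ := hS.exists_entourage_pow hK hKS n hE
    refine (eventually_ge_atTop (α := I) (OrderDual.toDual ⟨_, UniformSpace.ball_mem_nhds x hD⟩,
      OrderDual.toDual ⟨univ, univ_mem⟩)).mono fun i hi => ?_
    have hyD : (x, y i) ∈ D := hi.1 (hyN i)
    change n ≤ wordLen S (h i)⁻¹
    rw [wordLen_inv hSinv]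
    by_contra! hlt
    have hmem : s i * h i ∈ S ^ n := by
      refine Set.pow_subset_pow_right hS1 hlt ?_
      rw [Nat.succ_eq_add_one, pow_succ']
      exact Set.mul_mem_mul (hs i) (hlen i)
    exact hout i (hEV _ (hx _ (pow_subset_closure n hmem)) _ (hDE x hxK _ hyD _ hmem))
  obtain ⟨E', hE', hsymm, hcomp⟩ := comp_symm_mem_uniformity_sets hE
  obtain ⟨W, hW, hWE⟩ := hS z E' hE'
  obtain ⟨D, hD, hDW⟩ := UniformSpace.mem_nhds_iff.1 hW
  obtain ⟨D', hD', hcompD⟩ := comp_mem_uniformity_sets hD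
  obtain ⟨n, M, φ, c, -, hφ, hc⟩ :=
    hrec z hzV N (fun i => inv_mem (hh i)) htend _ (UniformSpace.ball_mem_nhds z hD')
  obtain ⟨K, hK, hzK, hKS⟩ := hcpt z hzV
  obtain ⟨Dn, hDn, hDnD⟩ := hS.exists_entourage_pow hK hKS n hD'
  have hev : ∀ᶠ i in N.atTop, (OrderDual.toDual ⟨univ, univ_mem⟩, OrderDual.toDual
      ⟨_, inter_mem hW (UniformSpace.ball_mem_nhds z hDn)⟩) ≤ (i : I) :=
    eventually_ge_atTop (α := I) _
  have hMne : M.atTop.NeBot := by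
    let := M.str
    have := M.directed
    have := M.nonempty
    exact (inferInstance : (atTop : Filter M.ι).NeBot)
  obtain ⟨j, hj, hj1⟩ := (hφ.eventually (hev.and (htend.eventually_ge_atTop 1))).exists
  obtain ⟨hcK, hcz, hcn⟩ := hc j
  set i : I := φ j
  have hyi : h i (y i) ∈ W ∩ UniformSpace.ball z Dn := hj.2 (hyW i)
  have hleni : wordLen S (N.toFun i) = wordLen S (h i) := wordLen_inv hSinv _
  rw [hleni] at hj1
  unfold Kset at hcK
  rw [hleni] at hcK
  obtain ⟨k, hk, _, rfl, hkc⟩ := hcK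
  have hkc : k * (h i)⁻¹ = c j := hkc
  have hcn : c j ∈ S ^ n := by
    refine mem_pow_of_wordLen_le hS1 (m := wordLen S (h i) - 1 + wordLen S (h i)) ?_ hcn
    rw [← hkc, pow_add]
    refine Set.mul_mem_mul hk ?_
    rw [← Set.mem_inv, ← inv_pow, hSinv]
    exact hlen i
  have hcy : c j (h i (y i)) = k (y i) := by
    rw [← mul_homeomorph_apply, ← hkc, inv_mul_cancel_right]
  have hkW : k (y i) ∈ W := by
    refine hDW (hcompD ⟨c j z, hcz, ?_⟩)
    rw [← hcy]
    exact hDnD z hzK _ hyi.2 _ hcn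
  have hsk : s i * k ∈ S ^ wordLen S (h i) := by
    rw [← Nat.sub_add_cancel hj1, pow_succ']
    exact Set.mul_mem_mul (hs i) hk
  exact hout i (hEV _ (hin i _ hsk) _
    (hcomp ⟨s i z, hsymm.symm _ _ (hWE _ (hs i) _ hkW), hWE _ (hs i) _ hyi.1⟩))

/-- Part of Theorem 1.4 ((i) ⇒ (v) with `W = U*`): if `S` is equicontinuous with respect to a
compatible uniformity, `1 ∈ S = S⁻¹`, `G = ⟨S⟩`, `U` is open, `U*` (the union of all compact
`G`-invariant subsets of `U`) is open and consists of `S`-recurrent points, then the orbit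
closure relation restricted to `U* × U*` is closed. -/
theorem orbit_closure_relation_closed_of_sRecurrent {X : Type u} [TopologicalSpace X]
    [T2Space X] [LocallyCompactSpace X] (hzd : ZeroDimensional X)
    (S : Set (X ≃ₜ X)) (hS1 : 1 ∈ S) (hSinv : S⁻¹ = S)
    (G : Subgroup (X ≃ₜ X)) (hSgen : Subgroup.closure S = G)
    (hequi : ∃ u : UniformSpace X, u.toTopologicalSpace = ‹TopologicalSpace X› ∧
      EquicontinuousSet u S)
    (U : Set X) (hU : IsOpen U)
    (Ustar : Set X)
    (hUstar : Ustar = ⋃₀ {K : Set X | K ⊆ U ∧ IsCompact K ∧ ∀ g ∈ G, (g : X ≃ₜ X) '' K = K})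
    (hopen : IsOpen Ustar) (hrec : ∀ x ∈ Ustar, SRecurrent S x) :
    IsClosed {p : ↥Ustar × ↥Ustar |
      (p.2 : X) ∈ closure (MulAction.orbit G (p.1 : X))} := by
  obtain ⟨u, rfl, hequi⟩ := hequi
  subst hSgen
  have hcpt : ∀ z ∈ Ustar, ∃ K ⊆ Ustar, IsCompact K ∧ z ∈ K ∧
      ∀ g ∈ Subgroup.closure S, ∀ k ∈ K, g k ∈ K := by
    rw [hUstar]
    rintro z ⟨K, hK, hzK⟩
    exact ⟨K, subset_sUnion_of_mem hK, hK.2.1, hzK, fun g hg k hk =>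
      hK.2.2 g hg ▸ mem_image_of_mem g hk⟩
  rw [← isOpen_compl_iff, isOpen_iff_mem_nhds]
  rintro ⟨⟨x, hx⟩, ⟨y, hy⟩⟩ hxy
  obtain ⟨K, hKU, hK, hxK, hKG⟩ := hcpt x hx
  have hsub : closure (MulAction.orbit (Subgroup.closure S) x) ⊆ K := by
    refine closure_minimal ?_ hK.isClosed
    rintro _ ⟨g, rfl⟩
    exact hKG g g.2 x hxK
  obtain ⟨V, hVc, hVo, hKV, hVU⟩ := hzd.exists_isCompact_isOpen_between
    (hK.of_isClosed_subset isClosed_closure hsub) (hopen.sdiff (isClosed_singleton (x := y)))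
    fun a ha => ⟨hKU (hsub ha), fun hay => hxy (by rw [mem_singleton_iff] at hay; exact hay ▸ ha)⟩
  obtain ⟨N, hN, hNV⟩ := exists_nhds_forall_mem_of_sRecurrent hS1 hSinv hequi hVc hVo
    (fun z hz => by
      obtain ⟨L, -, hL, hzL, hLG⟩ := hcpt z (hVU hz).1
      exact ⟨L, hL, hzL, fun s hs => hLG s (Subgroup.subset_closure hs)⟩)
    (fun z hz => hrec z (hVU hz).1) (x := x)
    (fun g hg => hKV (subset_closure ⟨⟨g, hg⟩, rfl⟩))
  have hyV : Vᶜ ∈ 𝓝 y := hVc.isClosed.isOpen_compl.mem_nhds fun hyV => (hVU hyV).2 rfl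
  filter_upwards [prod_mem_nhds (continuous_subtype_val.continuousAt.preimage_mem_nhds hN)
    (continuous_subtype_val.continuousAt.preimage_mem_nhds hyV)]
  rintro ⟨a, b⟩ ⟨ha, hb⟩ hab
  refine hb (closure_minimal ?_ hVc.isClosed hab)
  rintro _ ⟨g, rfl⟩
  exact hNV a ha g g.2

end Reid
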